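/- Let ⟨W, v⁺, v⁻⟩ be a BD model and μ : 2^W → [0,1] a classical (finitely additive) probability measure on W. Then for every L_BD formula φ: (i) μ(|φ|⁺) = μ(|φ|^b) + μ(|φ|^c); (ii) μ(|φ∧¬φ|⁺) = μ(|φ|^c); (iii) μ(|¬φ|⁺) − μ(|φ∧¬φ|⁺) = μ(|φ|^d); (iv) 1 − μ(|φ∨¬φ|⁺) = μ(|φ|^u). -/

import Mathlib

inductive BD : Type where
  | var : ℕ → BD
  | neg : BD → BD
  | and : BD → BD → BD
  | or  : BD → BD → BD

structure BDModel (W : Type) where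
  vpos : ℕ → Set W
  vneg : ℕ → Set W

mutual
  def suppT {W : Type} (M : BDModel W) : BD → W → Prop
    | .var p, w => w ∈ M.vpos p
    | .neg φ, w => suppF M φ w
    | .and φ χ, w => suppT M φ w ∧ suppT M χ w
    | .or φ χ, w => suppT M φ w ∨ suppT M χ w
  def suppF {W : Type} (M : BDModel W) : BD → W → Prop
    | .var p, w => w ∈ M.vneg p
    | .neg φ, w => suppT M φ w
    | .and φ χ, w => suppF M φ w ∨ suppF M χ w
    | .or φ χ, w => suppF M φ w ∧ suppF M χ w
end

def extP {W : Type} (M : BDModel W) (φ : BD) : Set W := {w | suppT M φ w}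
def extN {W : Type} (M : BDModel W) (φ : BD) : Set W := {w | suppF M φ w}

/-- Pure belief extension |φ|^b = |φ|⁺ ∖ |φ|⁻. -/
def extB {W : Type} (M : BDModel W) (φ : BD) : Set W := extP M φ \ extN M φ
/-- Pure disbelief extension |φ|^d = |φ|⁻ ∖ |φ|⁺. -/
def extD {W : Type} (M : BDModel W) (φ : BD) : Set W := extN M φ \ extP M φ
/-- Conflict extension |φ|^c = |φ|⁺ ∩ |φ|⁻. -/
def extC {W : Type} (M : BDModel W) (φ : BD) : Set W := extP M φ ∩ extN M φ
/-- Uncertainty extension |φ|^u = W ∖ (|φ|⁺ ∪ |φ|⁻). -/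
def extU {W : Type} (M : BDModel W) (φ : BD) : Set W := (extP M φ ∪ extN M φ)ᶜ

/-- A classical (finitely additive, normalized) probability measure on W. -/
def IsClassicalMeasure {W : Type} (mu : Set W → ℝ) : Prop :=
  (∀ X : Set W, mu X ∈ Set.Icc (0:ℝ) 1) ∧ mu Set.univ = 1 ∧
    ∀ X Y : Set W, Disjoint X Y → mu (X ∪ Y) = mu X + mu Y

@[simp] theorem extP_neg {W : Type} (M : BDModel W) (φ : BD) :
    extP M (.neg φ) = extN M φ := by
  ext w
  simp [extP, extN, suppT]

@[simp] theorem extP_and {W : Type} (M : BDModel W) (φ χ : BD) :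
    extP M (.and φ χ) = extP M φ ∩ extP M χ := by
  ext w
  simp [extP, suppT]

@[simp] theorem extP_or {W : Type} (M : BDModel W) (φ χ : BD) :
    extP M (.or φ χ) = extP M φ ∪ extP M χ := by
  ext w
  simp [extP, suppT]

theorem IsClassicalMeasure.diff_add_inter {W : Type} {mu : Set W → ℝ}
    (hmu : IsClassicalMeasure mu) (X Y : Set W) : mu X = mu (X \ Y) + mu (X ∩ Y) := by
  rw [← hmu.2.2 _ _ Set.disjoint_sdiff_inter, Set.sdiff_union_inter]

theorem IsClassicalMeasure.add_compl {W : Type} {mu : Set W → ℝ}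
    (hmu : IsClassicalMeasure mu) (X : Set W) : mu X + mu Xᶜ = 1 := by
  rw [← hmu.2.2 _ _ disjoint_compl_right, Set.union_compl_self, hmu.2.1]

theorem classical_measure_four_extensions {W : Type} [Nonempty W]
    (M : BDModel W) (mu : Set W → ℝ) (hcl : IsClassicalMeasure mu) (φ : BD) :
    mu (extP M φ) = mu (extB M φ) + mu (extC M φ) ∧
    mu (extP M (.and φ (.neg φ))) = mu (extC M φ) ∧
    mu (extP M (.neg φ)) - mu (extP M (.and φ (.neg φ))) = mu (extD M φ) ∧
    1 - mu (extP M (.or φ (.neg φ))) = mu (extU M φ) := by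
  simp only [extP_neg, extP_and, extP_or, extB, extC, extD, extU]
  refine ⟨hcl.diff_add_inter _ _, trivial, ?_, ?_⟩
  · rw [hcl.diff_add_inter (extN M φ) (extP M φ), Set.inter_comm, add_sub_cancel_right]
  · rw [← hcl.add_compl (extP M φ ∪ extN M φ), add_sub_cancel_left]
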